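/- arXiv:1810.02077 — 2 statements merged into one kernel-verified Lean document; each statement's English description precedes it below -/
import Mathlib

section
/- If F ∈ K[T0,T1,Z_0,Z_1,Z_2] lies in the kernel of ψ and is bihomogeneous of bidegree (i,j) with i + μ2·j < d − μ1, then F is a multiple of P = p_0·Z_0 + p_1·Z_1 + p_2·Z_2. -/
open MvPolynomial

noncomputable section

/-- The polynomial ring `K[T0,T1]`. -/
abbrev PT (K : Type) [Field K] := MvPolynomial (Fin 2) K

/-- The polynomial ring `K[T0,T1,s]`; `Sum.inr () = s`. -/
abbrev PTs (K : Type) [Field K] := MvPolynomial (Fin 2 ⊕ Unit) K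

/-- The polynomial ring `K[T0,T1,Z_0,Z_1,Z_2]`. -/
abbrev PTZ (K : Type) [Field K] := MvPolynomial (Fin 2 ⊕ Fin 3) K

/-- The map `ψ : K[T0,T1,Z_0,Z_1,Z_2] → K[T0,T1,s]` with `Z_i ↦ f_i·s`. -/
def psiMap (K : Type) [Field K] (f : Fin 3 → PT K) : PTZ K →ₐ[K] PTs K :=
  aeval (Sum.elim (fun i => X (Sum.inl i))
    (fun i => rename Sum.inl (f i) * X (Sum.inr ())))

/-- The cross product `p = A × B`. -/
def crossProd (K : Type) [Field K] (A B : Fin 3 → PT K) : Fin 3 → PT K :=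
  ![A 1 * B 2 - A 2 * B 1, A 2 * B 0 - A 0 * B 2, A 0 * B 1 - A 1 * B 0]

/-- Weight function giving degree in the variables `T0,T1`. -/
def wT : Fin 2 ⊕ Fin 3 → ℕ := Sum.elim (fun _ => 1) (fun _ => 0)

/-- Weight function giving degree in the variables `Z_0,Z_1,Z_2`. -/
def wZ : Fin 2 ⊕ Fin 3 → ℕ := Sum.elim (fun _ => 0) (fun _ => 1)

/-- Rescaling the variables of a weighted homogeneous polynomial by powers of `u`. -/
theorem MvPolynomial.IsWeightedHomogeneous.aeval_pow_mul {σ R S : Type*} [CommSemiring R]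
    [CommSemiring S] [Algebra R S] {w : σ → ℕ} {n : ℕ} {F : MvPolynomial σ R}
    (hF : F.IsWeightedHomogeneous w n) (u : S) (g : σ → S) :
    aeval (fun v => u ^ w v * g v) F = u ^ n * aeval g F := by
  simp only [aeval_def, eval₂_eq, Finset.mul_sum]
  refine Finset.sum_congr rfl fun m hm => ?_
  have hn : ∏ v ∈ m.support, (u ^ w v) ^ m v = u ^ n := by
    rw [← hF (mem_support_iff.1 hm), Finsupp.weight_apply, Finsupp.sum,
      ← Finset.prod_pow_eq_pow_sum]
    exact Finset.prod_congr rfl fun v _ => by rw [← pow_mul, smul_eq_mul, mul_comm]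
  simp only [mul_pow, Finset.prod_mul_distrib, hn]
  ring

/-- The coefficients of `H` have total degree at most `n`. -/
def CoeffTotalDegreeLE {σ R : Type*} [CommSemiring R] (n : ℕ)
    (H : Polynomial (MvPolynomial σ R)) : Prop :=
  ∀ k, (H.coeff k).totalDegree ≤ n

namespace CoeffTotalDegreeLE

variable {σ R : Type*} [CommSemiring R] {m n : ℕ} {G H : Polynomial (MvPolynomial σ R)}

theorem mono (h : CoeffTotalDegreeLE m H) (hmn : m ≤ n) : CoeffTotalDegreeLE n H :=
  fun k => (h k).trans hmn

theorem C {c : MvPolynomial σ R} (h : c.totalDegree ≤ n) :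
    CoeffTotalDegreeLE n (Polynomial.C c) := by
  intro k
  rw [Polynomial.coeff_C]
  split_ifs
  · exact h
  · simp

theorem X : CoeffTotalDegreeLE 0 (Polynomial.X : Polynomial (MvPolynomial σ R)) := by
  intro k
  rw [Polynomial.coeff_X]
  split_ifs <;> simp

theorem add (hG : CoeffTotalDegreeLE n G) (hH : CoeffTotalDegreeLE n H) :
    CoeffTotalDegreeLE n (G + H) := by
  intro k
  rw [Polynomial.coeff_add]
  exact (totalDegree_add _ _).trans (max_le (hG k) (hH k))

theorem sum {ι : Type*} {s : Finset ι} {G : ι → Polynomial (MvPolynomial σ R)}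
    (h : ∀ a ∈ s, CoeffTotalDegreeLE n (G a)) : CoeffTotalDegreeLE n (∑ a ∈ s, G a) := by
  intro k
  rw [Polynomial.finsetSum_coeff]
  exact totalDegree_finsetSum_le fun a ha => h a ha k

theorem mul (hG : CoeffTotalDegreeLE m G) (hH : CoeffTotalDegreeLE n H) :
    CoeffTotalDegreeLE (m + n) (G * H) := by
  intro k
  rw [Polynomial.coeff_mul]
  exact totalDegree_finsetSum_le fun a _ =>
    (totalDegree_mul _ _).trans (add_le_add (hG _) (hH _))

theorem pow (hG : CoeffTotalDegreeLE n G) (e : ℕ) : CoeffTotalDegreeLE (e * n) (G ^ e) := by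
  induction e with
  | zero => simpa using C (c := (1 : MvPolynomial σ R)) (n := 0) (by simp)
  | succ e ih => rw [pow_succ, add_mul, one_mul]; exact ih.mul hG

theorem prod {ι : Type*} {s : Finset ι} {G : ι → Polynomial (MvPolynomial σ R)} {e : ι → ℕ}
    (h : ∀ a ∈ s, CoeffTotalDegreeLE (e a) (G a)) :
    CoeffTotalDegreeLE (∑ a ∈ s, e a) (∏ a ∈ s, G a) := by
  classical
  induction s using Finset.induction_on with
  | empty => simpa using C (c := (1 : MvPolynomial σ R)) (n := 0) (by simp)
  | insert a s ha ih =>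
    rw [Finset.sum_insert ha, Finset.prod_insert ha]
    exact (h a (by simp)).mul (ih fun b hb => h b (by simp [hb]))

theorem aeval {τ : Type*} {w : τ → ℕ} {F : MvPolynomial τ R}
    {g : τ → Polynomial (MvPolynomial σ R)} (hg : ∀ v, CoeffTotalDegreeLE (w v) (g v))
    (hF : ∀ e ∈ F.support, Finsupp.weight w e ≤ n) :
    CoeffTotalDegreeLE n (MvPolynomial.aeval g F) := by
  rw [aeval_def, eval₂_eq]
  refine sum fun e he => ?_
  have hc : CoeffTotalDegreeLE 0
      (algebraMap R (Polynomial (MvPolynomial σ R)) (coeff e F)) := by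
    rw [Polynomial.algebraMap_apply]
    exact C (by simp [algebraMap_eq])
  refine (hc.mul (prod fun v _ => (hg v).pow (e v))).mono ?_
  rw [zero_add]
  simpa [Finsupp.weight_apply, Finsupp.sum] using hF e he

end CoeffTotalDegreeLE

/-- A polynomial over a factorial domain with a root `α / β` in lowest terms vanishes as soon as
its coefficients have smaller total degree than `α`. -/
theorem CoeffTotalDegreeLE.eq_zero_of_aeval_div_eq_zero {σ K L : Type*} [Field K] [Field L]
    [Algebra (MvPolynomial σ K) L] [IsFractionRing (MvPolynomial σ K) L]
    {α β : MvPolynomial σ K} (hα : α ≠ 0) (hβ : β ≠ 0) (hcop : IsRelPrime α β)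
    {n : ℕ} {H : Polynomial (MvPolynomial σ K)} (hH : CoeffTotalDegreeLE n H)
    (hn : n < α.totalDegree)
    (hroot : Polynomial.aeval (algebraMap _ L α / algebraMap _ L β) H = 0) : H = 0 := by
  by_contra hH0
  have hα' : algebraMap _ L α ≠ 0 := by simpa using hα
  have hβ' : algebraMap _ L β ≠ 0 := by simpa using hβ
  obtain ⟨q, hq, hndvd⟩ := H.exists_eq_pow_rootMultiplicity_mul_and_not_dvd hH0 0
  set m := H.rootMultiplicity 0
  rw [map_zero, sub_zero] at hq hndvd
  rw [Polynomial.X_dvd_iff] at hndvd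
  have hqroot : Polynomial.aeval (algebraMap _ L α / algebraMap _ L β) q = 0 := by
    rw [hq, map_mul, map_pow, Polynomial.aeval_X] at hroot
    exact (mul_eq_zero.1 hroot).resolve_left (pow_ne_zero _ (div_ne_zero hα' hβ'))
  have hnum := num_dvd_of_is_root hqroot
  set r := algebraMap _ L α / algebraMap _ L β with hr
  have hfrac := IsFractionRing.num_mul_den_eq_num_iff_eq (A := MvPolynomial σ K).2 (rfl : r = r)
  have hcross : α * (IsFractionRing.den (MvPolynomial σ K) r : MvPolynomial σ K) =
      β * IsFractionRing.num (MvPolynomial σ K) r := by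
    apply IsFractionRing.injective (MvPolynomial σ K) L
    rw [map_mul, map_mul, ← hfrac, hr]
    field_simp
  have hdvd : α ∣ q.coeff 0 :=
    (hcop.dvd_of_dvd_mul_left (Dvd.intro _ hcross)).trans hnum
  obtain ⟨c, hc⟩ := hdvd
  have hc0 : c ≠ 0 := by rintro rfl; simp_all
  have hcoeff : H.coeff m = q.coeff 0 := by
    rw [hq, Polynomial.coeff_X_pow_mul']; simp
  have := hH m
  rw [hcoeff, hc, totalDegree_mul_of_isDomain hα hc0] at this
  omega

/-- A form `F` in `Z`, evaluated at `u • z`. -/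
theorem MvPolynomial.IsWeightedHomogeneous.aeval_smul_wZ {K S : Type} [Field K] [CommRing S]
    [Algebra K S] {j : ℕ} {F : PTZ K} (hF : F.IsWeightedHomogeneous wZ j) (u : S)
    (t : Fin 2 → S) (z : Fin 3 → S) :
    aeval (Sum.elim t fun l => u * z l) F = u ^ j * aeval (Sum.elim t z) F := by
  rw [← hF.aeval_pow_mul]
  congr 2
  ext (v | v) <;> simp [wZ]

theorem aeval_eq_zero_of_psiMap_eq_zero {K : Type} [Field K] {f : Fin 3 → PT K} {F : PTZ K}
    (hF : psiMap K f F = 0) : aeval (Sum.elim X f) F = 0 := by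
  have h : (aeval (Sum.elim X fun _ => 1) : PTs K →ₐ[K] PT K).comp (psiMap K f) =
      aeval (Sum.elim X f) := by
    apply algHom_ext
    rintro (v | v)
    · simp [psiMap]
    · rw [AlgHom.comp_apply, psiMap, aeval_X, Sum.elim_inr, map_mul, aeval_rename,
        Sum.elim_comp_inl, aeval_X_left_apply, aeval_X, aeval_X, Sum.elim_inr, Sum.elim_inr,
        mul_one]
  rw [← h, AlgHom.comp_apply, hF, map_zero]

theorem map_aeval_sumElim {K S S' σ τ : Type*} [CommSemiring K] [CommSemiring S]
    [CommSemiring S'] [Algebra K S] [Algebra K S'] (φ : S →ₐ[K] S') (t : σ → S) (z : τ → S)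
    (F : MvPolynomial (σ ⊕ τ) K) :
    φ (aeval (Sum.elim t z) F) =
      aeval (Sum.elim (fun v => φ (t v)) fun l => φ (z l)) F := by
  rw [comp_aeval_apply]
  congr 2
  ext1 (v | v) <;> rfl

/-- The restriction of `F` to the affine line `Z = t A + B` over `K[T]`, with parameter `t`. -/
def restrictLine {K : Type} [Field K] (A B : Fin 3 → PT K) (F : PTZ K) : Polynomial (PT K) :=
  aeval (Sum.elim (fun v => Polynomial.C (X v))
    fun l => Polynomial.X * Polynomial.C (A l) + Polynomial.C (B l)) F

theorem aeval_add_eq_pow_mul_restrictLine {K L : Type} [Field K] [Field L] [Algebra K L]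
    {j : ℕ} {F : PTZ K} (hFZ : F.IsWeightedHomogeneous wZ j) (A B : Fin 3 → PT K)
    (φ : PT K →ₐ[K] L) (x : L) {y : L} (hy : y ≠ 0) :
    aeval (Sum.elim (fun v => φ (X v)) fun l => x * φ (A l) + y * φ (B l)) F =
      y ^ j * (restrictLine A B F).eval₂ (φ : PT K →+* L) (x / y) := by
  let ev : Polynomial (PT K) →ₐ[K] L :=
    { Polynomial.eval₂RingHom (φ : PT K →+* L) (x / y) with
      commutes' := fun r => by simp [Polynomial.algebraMap_apply] }
  have hev (H : Polynomial (PT K)) : ev H = H.eval₂ (φ : PT K →+* L) (x / y) := rfl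
  rw [← hev, restrictLine, map_aeval_sumElim, ← hFZ.aeval_smul_wZ]
  congr 2
  ext1 (v | v)
  · simp [hev]
  · simp [hev]
    field_simp

/-- If `F` vanishes on the generic point of the affine line `t A + B`, it vanishes at all
`x A + y B` with `y ≠ 0`. -/
theorem aeval_add_eq_zero {K S : Type} [Field K] [CommRing S] [IsDomain S] [Algebra K S]
    {j : ℕ} {F : PTZ K} (hFZ : F.IsWeightedHomogeneous wZ j) {A B : Fin 3 → PT K}
    (hF : restrictLine A B F = 0) (φ : PT K →ₐ[K] S) (x : S) {y : S} (hy : y ≠ 0) :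
    aeval (Sum.elim (fun v => φ (X v)) fun l => x * φ (A l) + y * φ (B l)) F = 0 := by
  let ι : S →ₐ[K] FractionRing S := IsScalarTower.toAlgHom K S _
  have hι : Function.Injective ι := IsFractionRing.injective S _
  have h := aeval_add_eq_pow_mul_restrictLine hFZ A B (ι.comp φ) (ι x)
    ((map_ne_zero_iff ι hι).2 hy)
  rw [hF, Polynomial.eval₂_zero, mul_zero] at h
  apply hι
  rw [map_aeval_sumElim, map_zero, ← h]
  simp

/-- The linear form `p_0 Z_0 + p_1 Z_1 + p_2 Z_2` of a primitive vector `p` is relatively prime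
to each nonzero `p_k`. -/
theorem isRelPrime_linearForm {K : Type} [Field K] {p : Fin 3 → PT K}
    (hp : ∀ c : PT K, (∀ i, c ∣ p i) → IsUnit c) {k : Fin 3} (hk : p k ≠ 0) :
    IsRelPrime (∑ l : Fin 3, (rename Sum.inl (p l) : PTZ K) * X (Sum.inr l))
      (rename Sum.inl (p k)) := by
  let φ : PTZ K ≃ₐ[K] MvPolynomial (Fin 3) (PT K) :=
    (renameEquiv K (Equiv.sumComm _ _)).trans (sumAlgEquiv K (Fin 3) (Fin 2))
  have hφC (q : PT K) : φ (rename Sum.inl q) = C q := by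
    have : (φ : PTZ K →ₐ[K] _).comp (rename Sum.inl) =
        (IsScalarTower.toAlgHom K (PT K) (MvPolynomial (Fin 3) (PT K))) := by
      ext v
      simp [φ, algebraMap_eq]
    simpa [algebraMap_eq] using DFunLike.congr_fun this q
  have hφX (l : Fin 3) : φ (X (Sum.inr l)) = X l := by simp [φ]
  intro c hc hck
  have h1 : φ c ∣ C (p k) := hφC (p k) ▸ map_dvd φ hck
  obtain ⟨b, -, hb⟩ := (dvd_C_iff_exists hk).1 h1
  have h2 := map_dvd φ hc
  rw [hb, C_dvd_iff_dvd_coeff] at h2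
  have hbu : IsUnit b := hp b fun l => by
    have := h2 (Finsupp.single l 1)
    simpa [hφC, hφX, coeff_C_mul, coeff_X, coeff_sum, Finsupp.single_left_inj] using this
  have := hbu.map (C : PT K →+* MvPolynomial (Fin 3) (PT K))
  rw [← hb] at this
  exact (MulEquiv.isUnit_map φ).1 this

/-- If `z` is congruent to `c Z` modulo `P` and `F` vanishes at `Z = z`, then `P` divides `c ^ j F`. -/
theorem dvd_pow_mul_of_aeval_eq_zero {K : Type} [Field K] {j : ℕ} {F P c : PTZ K}
    (hFZ : F.IsWeightedHomogeneous wZ j) {z : Fin 3 → PTZ K}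
    (hz : ∀ l, P ∣ c * X (Sum.inr l) - z l)
    (hF : aeval (Sum.elim (fun v => X (Sum.inl v)) z) F = 0) : P ∣ c ^ j * F := by
  have h := hFZ.aeval_smul_wZ c (fun v => X (Sum.inl v)) fun l => X (Sum.inr l)
  have hX : (Sum.elim (fun v => X (Sum.inl v)) fun l => X (Sum.inr l) :
      Fin 2 ⊕ Fin 3 → PTZ K) = X := by ext1 (v | v) <;> rfl
  rw [hX, aeval_X_left_apply] at h
  let π := Ideal.Quotient.mkₐ K (Ideal.span {P})
  have hπ (l : Fin 3) : π (c * X (Sum.inr l)) = π (z l) :=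
    Ideal.Quotient.eq.2 (Ideal.mem_span_singleton.2 (hz l))
  rw [← h, ← Ideal.mem_span_singleton, ← Ideal.Quotient.eq_zero_iff_mem]
  change π _ = 0
  rw [map_aeval_sumElim, funext hπ, ← map_aeval_sumElim, hF, map_zero]

theorem linearForm_dvd {K : Type} [Field K] {j : ℕ} {F : PTZ K}
    (hFZ : F.IsWeightedHomogeneous wZ j) {A B : Fin 3 → PT K}
    (hp0 : ¬ (∀ i, crossProd K A B i = 0))
    (hpcop : ∀ c : PT K, (∀ i, c ∣ crossProd K A B i) → IsUnit c)
    (hF : restrictLine A B F = 0) :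
    (∑ k : Fin 3, (rename Sum.inl (crossProd K A B k) : PTZ K) * X (Sum.inr k)) ∣ F := by
  push Not at hp0
  obtain ⟨k, hk⟩ := hp0
  refine ((isRelPrime_linearForm hpcop hk).pow_right (n := j)).dvd_of_dvd_mul_left ?_
  let a (l : Fin 3) : PTZ K := rename Sum.inl (A l)
  let b (l : Fin 3) : PTZ K := rename Sum.inl (B l)
  let Z (l : Fin 3) : PTZ K := X (Sum.inr l)
  let x : PTZ K := Z (k + 1) * b (k + 2) - Z (k + 2) * b (k + 1)
  let y : PTZ K := a (k + 1) * Z (k + 2) - a (k + 2) * Z (k + 1)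
  have hy : y ≠ 0 := by
    intro h
    apply hk
    have := congrArg (aeval (Sum.elim X B) : PTZ K →ₐ[K] PT K) h
    simp only [y, a, Z, map_sub, map_mul, aeval_rename, Sum.elim_comp_inl, aeval_X,
      aeval_X_left_apply, Sum.elim_inr, map_zero] at this
    fin_cases k <;> simpa [crossProd] using this
  refine dvd_pow_mul_of_aeval_eq_zero hFZ (z := fun l => x * a l + y * b l) (fun l => ?_) ?_
  · refine ⟨if l = k then 1 else 0, ?_⟩
    fin_cases k <;> fin_cases l <;>
      simp [x, y, a, b, Z, crossProd, Fin.sum_univ_three] <;> ring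
  · simpa [a, b] using aeval_add_eq_zero hFZ hF (rename Sum.inl : PT K →ₐ[K] PTZ K) x hy

theorem stmt11 (K : Type) [Field K] (d μ1 μ2 : ℕ) (hμ12 : μ1 ≤ μ2)
    (hd : 2 * (μ1 + μ2) ≤ d)
    (α β : PT K) (hα0 : α ≠ 0) (hβ0 : β ≠ 0)
    (hα : α.IsHomogeneous (d - μ1)) (hβ : β.IsHomogeneous (d - μ2))
    (hcop : ∀ c : PT K, c ∣ α → c ∣ β → IsUnit c)
    (A B : Fin 3 → PT K)
    (hAhom : ∀ i, (A i).IsHomogeneous μ1) (hBhom : ∀ i, (B i).IsHomogeneous μ2)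
    (hp0 : ¬ (∀ i, crossProd K A B i = 0))
    (hpcop : ∀ c : PT K, (∀ i, c ∣ crossProd K A B i) → IsUnit c)
    (f : Fin 3 → PT K) (hf : ∀ i, f i = α * A i + β * B i)
    (F : PTZ K) (hFker : psiMap K f F = 0)
    (i j : ℕ) (hFT : F.IsWeightedHomogeneous wT i)
    (hFZ : F.IsWeightedHomogeneous wZ j)
    (hij : i + μ2 * j < d - μ1) :
    (∑ k : Fin 3, (rename Sum.inl (crossProd K A B k) : PTZ K) * X (Sum.inr k)) ∣ F := by
  have hαd : α.totalDegree = d - μ1 := hα.totalDegree hα0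
  refine linearForm_dvd hFZ hp0 hpcop ?_
  have hdeg : CoeffTotalDegreeLE (i + μ2 * j) (restrictLine A B F) := by
    refine CoeffTotalDegreeLE.aeval (w := fun v => wT v + μ2 * wZ v) ?_ fun e he => ?_
    · rintro (v | l)
      · exact .C (by simp [wT, wZ])
      · refine .add ?_ (.C ?_)
        · exact (CoeffTotalDegreeLE.X.mul (.C (hAhom l).totalDegree_le)).mono
            (by simpa [wT, wZ] using hμ12)
        · simpa [wT, wZ] using (hBhom l).totalDegree_le
    · have h1 := hFT (mem_support_iff.1 he)
      have h2 := hFZ (mem_support_iff.1 he)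
      rw [← h1, ← h2]
      simp only [Finsupp.weight_apply, Finsupp.sum, smul_eq_mul, Finset.mul_sum,
        ← Finset.sum_add_distrib]
      exact (Finset.sum_congr rfl fun v _ => by ring).le
  let L := FractionRing (PT K)
  let ι : PT K →ₐ[K] L := IsScalarTower.toAlgHom K (PT K) L
  have hβ' : ι β ≠ 0 := (map_ne_zero_iff ι (IsFractionRing.injective (PT K) L)).2 hβ0
  refine hdeg.eq_zero_of_aeval_div_eq_zero (L := L) hα0 hβ0 (fun c => hcop c) (hαd ▸ hij) ?_
  have hker := congrArg ι (aeval_eq_zero_of_psiMap_eq_zero hFker)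
  have h := aeval_add_eq_pow_mul_restrictLine hFZ A B ι (ι α) hβ'
  simp only [← map_mul, ← map_add, ← hf] at h
  rw [← map_aeval_sumElim, hker, map_zero] at h
  exact (mul_eq_zero.1 h.symm).resolve_left (pow_ne_zero _ hβ')
end
end

section
/- Assume 1 ≤ μ1, and suppose q = (q_0,q_1,q_2) ∈ K[T0,T1]³ has each q_i homogeneous of degree d−μ and satisfies f = p × q componentwise. Then for all nonnegative integers a, b such that either b ≥ 1 and d − μ − a·μ1 − b·μ2 ≥ μ − 1, or b = 0 and d − μ − a·μ1 ≥ μ + μ2 − μ1 − 1, there exists F_{a,b} in the kernel of ψ which is bihomogeneous of bidegree (d − μ − a·μ1 − b·μ2, a + b + 1) and satisfies Ω(F_{a,b}) = (−1)^{b+1}·X^a·Y^b·(α·Y − β·X); moreover, the family of all such F_{a,b} is contained in a finite generating set G of the kernel of ψ with the property that no proper subset of G generates the kernel of ψ. -/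
open MvPolynomial

noncomputable section

/-- The polynomial ring `K[T0,T1,X,Y]`; `Sum.inr 0 = X`, `Sum.inr 1 = Y`. -/
abbrev PTXY (K : Type) [Field K] := MvPolynomial (Fin 2 ⊕ Fin 2) K

/-- The map `Ω : K[T0,T1,Z_0,Z_1,Z_2] → K[T0,T1,X,Y]` with `Z_i ↦ A_i·X + B_i·Y`. -/
def OmegaMap (K : Type) [Field K] (A B : Fin 3 → PT K) : PTZ K →ₐ[K] PTXY K :=
  aeval (Sum.elim (fun i => X (Sum.inl i))
    (fun i => rename Sum.inl (A i) * X (Sum.inr 0) + rename Sum.inl (B i) * X (Sum.inr 1)))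

/-- The condition on `(a,b)` in Theorem `DD`: either `b ≥ 1` and
`d − μ − a·μ1 − b·μ2 ≥ μ − 1`, or `b = 0` and `d − μ − a·μ1 ≥ μ + μ2 − μ1 − 1`. -/
def CondAB (d μ1 μ2 : ℕ) (a b : ℕ) : Prop :=
  (1 ≤ b ∧ (μ1 : ℤ) + μ2 - 1 ≤ (d : ℤ) - (μ1 + μ2) - a * μ1 - b * μ2) ∨
  (b = 0 ∧ (μ1 : ℤ) + μ2 + μ2 - μ1 - 1 ≤ (d : ℤ) - (μ1 + μ2) - a * μ1)
theorem finrank_homogeneousSubmodule_fin_two (K : Type*) [Field K] (n : ℕ) :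
    Module.finrank K (homogeneousSubmodule (Fin 2) K n) = n + 1 := by
  rw [homogeneousSubmodule_eq_finsupp_supported]
  have hs : {d : Fin 2 →₀ ℕ | d.degree = n} =
      (Finset.finsuppAntidiag (Finset.univ : Finset (Fin 2)) n : Set (Fin 2 →₀ ℕ)) := by
    ext d
    simp [Finsupp.degree_eq_sum]
  rw [hs]
  refine (Module.finrank_eq_card_basis (basisRestrictSupport K _)).trans ?_
  simp [Finset.card_finsuppAntidiag_nat_eq_choose, Nat.add_comm 1 n]

theorem dvd_of_dvd_mul_of_isUnit_of_dvd {R : Type*} [CommRing R] [IsDomain R]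
    [UniqueFactorizationMonoid R] (x : Fin 3 → R)
    (hx : ∀ c, (∀ i, c ∣ x i) → IsUnit c) {a y : R} (h : ∀ i, a ∣ x i * y) : a ∣ y := by
  let := UniqueFactorizationMonoid.toGCDMonoid R
  have hu : IsUnit (gcd (gcd (x 0) (x 1)) (x 2)) := by
    refine hx _ fun i => ?_
    fin_cases i
    · exact (gcd_dvd_left _ _).trans (gcd_dvd_left _ _)
    · exact (gcd_dvd_left _ _).trans (gcd_dvd_right _ _)
    · exact gcd_dvd_right _ _
  have h01 : a ∣ gcd (x 0) (x 1) * y :=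
    (dvd_gcd (h 0) (h 1)).trans (gcd_mul_right' y (x 0) (x 1)).dvd
  have h012 : a ∣ gcd (gcd (x 0) (x 1)) (x 2) * y :=
    (dvd_gcd h01 (h 2)).trans (gcd_mul_right' y (gcd (x 0) (x 1)) (x 2)).dvd
  exact (hu.dvd_mul_left).1 h012

section SyzygyBasis

variable {K : Type} [Field K] {A B : Fin 3 → PT K}

theorem isUnit_of_forall_dvd_crossProd
    (hgen : ∀ h : Fin 3 → PT K, (∑ i : Fin 3, h i * crossProd K A B i = 0) →
      ∃ u v : PT K, ∀ i, h i = u * A i + v * B i)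
    (hindep : ∀ u v : PT K, (∀ i, u * A i + v * B i = 0) → u = 0 ∧ v = 0)
    {c : PT K} (hdvd : ∀ i, c ∣ crossProd K A B i) : IsUnit c := by
  have key : ∀ u v : PT K, (∀ i, c ∣ u * A i + v * B i) → c ∣ u ∧ c ∣ v := by
    intro u v huv
    rcases eq_or_ne c 0 with rfl | hc
    · simpa using hindep u v fun i => zero_dvd_iff.1 (huv i)
    choose h hh using huv
    have hsyz : ∑ i : Fin 3, h i * crossProd K A B i = 0 := by
      apply mul_left_cancel₀ hc
      have h0 := hh 0
      have h1 := hh 1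
      have h2 := hh 2
      simp only [Fin.sum_univ_three, crossProd, Matrix.cons_val_zero, Matrix.cons_val_one,
        Matrix.cons_val]
      linear_combination -(A 1 * B 2 - A 2 * B 1) * h0 - (A 2 * B 0 - A 0 * B 2) * h1
        - (A 0 * B 1 - A 1 * B 0) * h2
    obtain ⟨u', v', h'⟩ := hgen h hsyz
    obtain ⟨h1, h2⟩ := hindep (u - c * u') (v - c * v') fun i => by
      linear_combination hh i + c * h' i
    exact ⟨⟨u', sub_eq_zero.1 h1⟩, ⟨v', sub_eq_zero.1 h2⟩⟩
  obtain ⟨x, hx⟩ := hdvd 0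
  obtain ⟨y, hy⟩ := hdvd 1
  obtain ⟨z, hz⟩ := hdvd 2
  simp only [crossProd, Matrix.cons_val_zero, Matrix.cons_val_one, Matrix.cons_val] at hx hy hz
  have hA : ∀ j, c ∣ A j := by
    intro j
    refine dvd_neg.1 (key (B j) (-A j) fun i => ?_).2
    fin_cases j <;> fin_cases i <;> simp only [Fin.zero_eta, Fin.mk_one, Fin.reduceFinMk]
    · exact ⟨0, by ring⟩
    · exact ⟨-z, by linear_combination -hz⟩
    · exact ⟨y, by linear_combination hy⟩
    · exact ⟨z, by linear_combination hz⟩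
    · exact ⟨0, by ring⟩
    · exact ⟨-x, by linear_combination -hx⟩
    · exact ⟨-y, by linear_combination -hy⟩
    · exact ⟨x, by linear_combination hx⟩
    · exact ⟨0, by ring⟩
  exact isUnit_of_dvd_one (key 1 0 fun i => by simpa using hA i).1

theorem exists_eq_mul_crossProd
    (hgen : ∀ h : Fin 3 → PT K, (∑ i : Fin 3, h i * crossProd K A B i = 0) →
      ∃ u v : PT K, ∀ i, h i = u * A i + v * B i)
    (hindep : ∀ u v : PT K, (∀ i, u * A i + v * B i = 0) → u = 0 ∧ v = 0)
    {g : Fin 3 → PT K} (hgA : ∑ i, g i * A i = 0) (hgB : ∑ i, g i * B i = 0) :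
    ∃ u, ∀ i, g i = u * crossProd K A B i := by
  obtain ⟨j, hj⟩ : ∃ j, crossProd K A B j ≠ 0 := by
    by_contra! h
    exact not_isUnit_zero
      (isUnit_of_forall_dvd_crossProd hgen hindep fun i => (h i).symm ▸ dvd_rfl)
  have hprop : ∀ i, crossProd K A B j * g i = crossProd K A B i * g j := by
    intro i
    simp only [Fin.sum_univ_three] at hgA hgB
    fin_cases j <;> fin_cases i <;> simp [crossProd] <;> grind
  obtain ⟨u, hu⟩ := dvd_of_dvd_mul_of_isUnit_of_dvd (crossProd K A B)
    (fun c hc => isUnit_of_forall_dvd_crossProd hgen hindep hc)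
    (fun i => ⟨g i, (hprop i).symm⟩ : ∀ i, crossProd K A B j ∣ crossProd K A B i * g j)
  refine ⟨u, fun i => mul_left_cancel₀ hj ?_⟩
  rw [hprop i, hu]
  ring

theorem isHomogeneous_crossProd {μ1 μ2 : ℕ}
    (hA : ∀ i, (A i).IsHomogeneous μ1) (hB : ∀ i, (B i).IsHomogeneous μ2) (i : Fin 3) :
    (crossProd K A B i).IsHomogeneous (μ1 + μ2) := by
  fin_cases i <;> exact ((hA _).mul (hB _)).sub ((hA _).mul (hB _))

end SyzygyBasis

theorem rename_inl_of_dvd {σ τ R : Type*} [CommRing R] [IsDomain R] {a : MvPolynomial σ R}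
    (ha : a ≠ 0) {c : MvPolynomial (σ ⊕ τ) R} (hc : c ∣ rename Sum.inl a) :
    ∃ b, b ∣ a ∧ c = rename Sum.inl b := by
  let e := (renameEquiv R (Equiv.sumComm σ τ)).trans (sumAlgEquiv R τ σ)
  have he : ∀ b : MvPolynomial σ R, e (rename Sum.inl b) = C b := by
    intro b
    have := DFunLike.congr_fun (sumAlgEquiv_comp_rename_inr R τ σ) b
    simpa [e, rename_rename, Function.comp_def] using this
  have h1 : e c ∣ C a := he a ▸ map_dvd e hc
  obtain ⟨b, hb, hcb⟩ := (dvd_C_iff_exists ha).1 h1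
  exact ⟨b, hb, e.injective (by rw [hcb, he])⟩

section SubstitutionKernel

variable {K : Type} [Field K]

/-- The map `K[T0,T1,X,Y] → K[T0,T1,s]` with `X ↦ α·s` and `Y ↦ β·s`. -/
def scaleMap (α β : PT K) : PTXY K →ₐ[K] PTs K :=
  aeval (Sum.elim (fun i => X (Sum.inl i))
    (fun j => rename Sum.inl (![α, β] j) * X (Sum.inr ())))

/-- The polynomial `α·Y - β·X`. -/
def pencil (α β : PT K) : PTXY K :=
  rename Sum.inl α * X (Sum.inr 1) - rename Sum.inl β * X (Sum.inr 0)

@[simp] theorem scaleMap_X_inl (α β : PT K) (i : Fin 2) :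
    scaleMap α β (X (Sum.inl i)) = X (Sum.inl i) := by simp [scaleMap]

@[simp] theorem scaleMap_X_inr (α β : PT K) (j : Fin 2) :
    scaleMap α β (X (Sum.inr j)) = rename Sum.inl (![α, β] j) * X (Sum.inr ()) := by
  simp [scaleMap]

@[simp] theorem scaleMap_rename_inl (α β c : PT K) :
    scaleMap α β (rename Sum.inl c) = rename Sum.inl c := by
  rw [scaleMap, aeval_rename, rename_eq_aeval]
  rfl

theorem scaleMap_pencil (α β : PT K) : scaleMap α β (pencil α β) = 0 := by
  simp [pencil]
  ring

/-- The inclusion `K[T0,T1,s] → K[T0,T1,X,Y]` with `s ↦ X`. -/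
def inclX : PTs K →ₐ[K] PTXY K := rename (Sum.map id fun _ => 0)

theorem inclX_rename_inl (c : PT K) : inclX (rename Sum.inl c) = rename Sum.inl c := by
  rw [inclX, rename_rename]
  rfl

theorem scaleMap_inclX_injective {α β : PT K} (hα : α ≠ 0) :
    Function.Injective ((scaleMap α β).comp inclX) := by
  let L := FractionRing (PTs K)
  let u : L := algebraMap (PTs K) L (rename Sum.inl α)
  have hu : u ≠ 0 := by
    rw [Ne, FaithfulSMul.algebraMap_eq_zero_iff]
    exact (map_ne_zero_iff _ (rename_injective _ Sum.inl_injective)).2 hα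
  let U : PTs K →ₐ[K] L := aeval (Sum.elim (fun i => algebraMap (PTs K) L (X (Sum.inl i)))
    (fun _ => u⁻¹ * algebraMap (PTs K) L (X (Sum.inr ()))))
  have hUα : U (rename Sum.inl α) = u := by
    have : (U.comp (rename Sum.inl)) = (IsScalarTower.toAlgHom K (PTs K) L).comp (rename Sum.inl) := by
      ext i
      simp [U]
    exact DFunLike.congr_fun this α
  have hU : U.comp ((scaleMap α β).comp inclX) = IsScalarTower.toAlgHom K (PTs K) L := by
    ext i
    rcases i with i | i
    · simp [U, inclX]
    · simp only [inclX, AlgHom.comp_apply, rename_X, Sum.map_inr, scaleMap_X_inr, map_mul,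
        Matrix.cons_val_zero, hUα]
      simp [U, mul_inv_cancel_left₀ hu]
  have hinj : Function.Injective (U.comp ((scaleMap α β).comp inclX)) := by
    rw [hU]
    exact IsFractionRing.injective (PTs K) L
  exact fun x y hxy => hinj (congrArg U hxy)

theorem exists_pencil_dvd_pow_mul_sub (α β : PT K) (P : PTXY K) :
    ∃ (N : ℕ) (r : PTs K), pencil α β ∣ (rename Sum.inl α) ^ N * P - inclX r := by
  induction P using MvPolynomial.induction_on with
  | C a => exact ⟨0, C a, by simp [inclX]⟩
  | add P Q hP hQ =>
    obtain ⟨N, r, x, hx⟩ := hP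
    obtain ⟨M, s, y, hy⟩ := hQ
    refine ⟨N + M, (rename Sum.inl α) ^ M * r + (rename Sum.inl α) ^ N * s,
      (rename Sum.inl α) ^ M * x + (rename Sum.inl α) ^ N * y, ?_⟩
    simp only [map_add, map_mul, map_pow, inclX_rename_inl]
    linear_combination (rename Sum.inl α) ^ M * hx + (rename Sum.inl α) ^ N * hy
  | mul_X P i hP =>
    obtain ⟨N, r, x, hx⟩ := hP
    rcases i with i | i
    · refine ⟨N, r * X (Sum.inl i), x * X (Sum.inl i), ?_⟩
      have : inclX (X (Sum.inl i)) = (X (Sum.inl i) : PTXY K) := by simp [inclX]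
      rw [map_mul, this]
      linear_combination X (Sum.inl i) * hx
    · have hs : inclX (X (Sum.inr ())) = (X (Sum.inr 0) : PTXY K) := by simp [inclX]
      fin_cases i
      · refine ⟨N, r * X (Sum.inr ()), x * X (Sum.inr 0), ?_⟩
        simp only [map_mul, hs, Fin.zero_eta]
        linear_combination X (Sum.inr 0) * hx
      · refine ⟨N + 1, rename Sum.inl β * r * X (Sum.inr ()),
          rename Sum.inl α ^ N * P + rename Sum.inl β * X (Sum.inr 0) * x, ?_⟩
        simp only [map_mul, hs, inclX_rename_inl, Fin.mk_one, pencil]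
        rw [pencil] at hx
        linear_combination rename Sum.inl β * X (Sum.inr 0) * hx

theorem isRelPrime_rename_pencil {α β : PT K} (hα : α ≠ 0) (h : IsRelPrime α β) :
    IsRelPrime (rename Sum.inl α) (pencil α β) := by
  intro c hc hcD
  obtain ⟨b, hb, rfl⟩ := rename_inl_of_dvd hα hc
  let κ : PTXY K →ₐ[K] PT K := aeval (Sum.elim X ![1, 0])
  have hκ : ∀ c, κ (rename Sum.inl c) = c := by
    intro c
    simp only [κ, aeval_rename]
    exact aeval_X_left_apply c
  have h1 := map_dvd κ hcD
  rw [pencil, map_sub, map_mul, map_mul, hκ, hκ, hκ] at h1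
  have h2 : b ∣ β := by simpa [κ] using h1
  exact (h hb h2).map (rename Sum.inl)

theorem pencil_dvd_of_scaleMap_eq_zero {α β : PT K} (hα : α ≠ 0) (h : IsRelPrime α β)
    {P : PTXY K} (hP : scaleMap α β P = 0) : pencil α β ∣ P := by
  obtain ⟨N, r, hr⟩ := exists_pencil_dvd_pow_mul_sub α β P
  have h0 : ((scaleMap α β).comp inclX) r = 0 := by
    obtain ⟨x, hx⟩ := hr
    have := congrArg (scaleMap α β) hx
    simpa [hP, scaleMap_pencil] using this
  have hr0 : r = 0 := scaleMap_inclX_injective hα (h0.trans (map_zero _).symm)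
  rw [hr0, map_zero, sub_zero] at hr
  exact ((isRelPrime_rename_pencil hα h).pow_left (m := N)).symm.dvd_of_dvd_mul_left hr

end SubstitutionKernel

section MinimalGenerators

variable {σ K : Type} [Field K]

theorem weightedHomogeneousComponent_mul_right {w : σ → ℕ} {m : ℕ} {k : MvPolynomial σ K}
    (hk : k.IsWeightedHomogeneous w m) (c : MvPolynomial σ K) (n : ℕ) :
    weightedHomogeneousComponent w n (c * k) =
      (if m ≤ n then weightedHomogeneousComponent w (n - m) c else 0) * k := by
  induction c using MvPolynomial.induction_on' with
  | monomial u a =>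
    have hu := isWeightedHomogeneous_monomial w u a (rfl : Finsupp.weight w u = _)
    rw [weightedHomogeneousComponent_of_mem (hu.mul hk)]
    split_ifs with h1 h2 h2
    · rw [weightedHomogeneousComponent_of_mem hu, if_pos (by omega)]
    · omega
    · rw [weightedHomogeneousComponent_of_mem hu, if_neg (by omega), zero_mul]
    · simp
  | add p q hp hq =>
    rw [add_mul, map_add, hp, hq]
    split_ifs
    · rw [map_add, add_mul]
    · simp

theorem exists_finset_isWeightedHomogeneous_span_eq [Finite σ] (w : σ → ℕ)
    (I : Ideal (MvPolynomial σ K))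
    (hI : ∀ x ∈ I, ∀ n, weightedHomogeneousComponent w n x ∈ I) :
    ∃ W : Finset (MvPolynomial σ K),
      Ideal.span (W : Set (MvPolynomial σ K)) = I ∧
      ∀ g ∈ W, ∃ n, g.IsWeightedHomogeneous w n := by
  classical
  obtain ⟨V, hV⟩ := (isNoetherianRing_iff_ideal_fg _).1 inferInstance I
  have hfin : ∀ v : MvPolynomial σ K,
      (Function.support fun n => weightedHomogeneousComponent w n v).Finite :=
    fun v => weightedHomogeneousComponent_finsupp v
  refine ⟨V.biUnion fun v =>
    (hfin v).toFinset.image fun n => weightedHomogeneousComponent w n v, ?_, ?_⟩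
  · apply le_antisymm
    · rw [Ideal.span_le]
      intro x hx
      simp only [Finset.coe_biUnion, Finset.coe_image, Set.mem_iUnion, Set.mem_image] at hx
      obtain ⟨v, hv, n, -, rfl⟩ := hx
      exact hI _ (hV ▸ Ideal.subset_span hv) _
    · rw [← hV]
      refine Ideal.span_le.2 fun v hv => ?_
      rw [SetLike.mem_coe, ← sum_weightedHomogeneousComponent w v, finsum_eq_sum _ (hfin v)]
      refine Ideal.sum_mem _ fun n hn => Ideal.subset_span ?_
      exact Finset.mem_coe.2 (Finset.mem_biUnion.2 ⟨v, hv, Finset.mem_image_of_mem _ hn⟩)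
  · intro g hg
    obtain ⟨v, -, hg⟩ := Finset.mem_biUnion.1 hg
    obtain ⟨n, -, rfl⟩ := Finset.mem_image.1 hg
    exact ⟨n, weightedHomogeneousComponent_isWeightedHomogeneous n v⟩

/-- Homogeneous elements of a homogeneous ideal `I` that are linearly independent modulo `𝔪 * I`,
with `𝔪` the irrelevant ideal, belong to a finite irredundant generating set of `I`. -/
theorem exists_irredundant_generators [Finite σ] (w : σ → ℕ) (hw : ∀ i, w i ≠ 0)
    (I : Ideal (MvPolynomial σ K))
    (hI : ∀ x ∈ I, ∀ n, weightedHomogeneousComponent w n x ∈ I)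
    (S : Finset (MvPolynomial σ K)) (hSI : ∀ g ∈ S, g ∈ I)
    (hS : ∀ g ∈ S, ∃ n, g.IsWeightedHomogeneous w n)
    (hind : ∀ c : MvPolynomial σ K → K,
      ∑ k ∈ S, C (c k) * k ∈ RingHom.ker (constantCoeff : MvPolynomial σ K →+* K) * I →
        ∀ k ∈ S, c k = 0) :
    ∃ G : Finset (MvPolynomial σ K), Ideal.span (G : Set (MvPolynomial σ K)) = I ∧ S ⊆ G ∧
      ∀ G' ⊂ G, Ideal.span (G' : Set (MvPolynomial σ K)) ≠ I := by
  classical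
  obtain ⟨W, hWspan, hW⟩ := exists_finset_isWeightedHomogeneous_span_eq w I hI
  have hle : ∀ H ⊆ W, Ideal.span ((S ∪ H : Finset _) : Set (MvPolynomial σ K)) ≤ I := by
    intro H hH
    refine Ideal.span_le.2 fun x hx => ?_
    rcases Finset.mem_union.1 (Finset.mem_coe.1 hx) with h | h
    · exact hSI x h
    · exact hWspan ▸ Ideal.subset_span (hH h)
  obtain ⟨H, -, hH⟩ := exists_minimal_le_of_wellFoundedLT
    (fun H : Finset (MvPolynomial σ K) => H ⊆ W ∧
      I ≤ Ideal.span ((S ∪ H : Finset _) : Set (MvPolynomial σ K))) W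
    ⟨subset_rfl, hWspan.symm.le.trans (Ideal.span_mono (by simp))⟩
  obtain ⟨⟨hHW, hHspan⟩, hmin⟩ := hH
  -- no element of `H` can be dropped
  have hdrop : ∀ h ∈ H, h ∉ Ideal.span (((S ∪ H).erase h : Finset _) : Set (MvPolynomial σ K)) := by
    intro h hh hmem
    have hsub : (S ∪ H).erase h ⊆ S ∪ H.erase h := by
      intro x hx
      simp only [Finset.mem_erase, Finset.mem_union] at hx ⊢
      tauto
    have hmem' := Ideal.span_mono (Finset.coe_subset.2 hsub) hmem
    have := hmin (y := H.erase h) ⟨(Finset.erase_subset _ _).trans hHW, ?_⟩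
      (Finset.erase_subset _ _) hh
    · simp at this
    · refine hHspan.trans (Ideal.span_le.2 fun x hx => ?_)
      by_cases hxh : x = h
      · exact hxh ▸ hmem'
      · refine Ideal.subset_span ?_
        have := Finset.mem_union.1 (Finset.mem_coe.1 hx)
        simp only [Finset.coe_union, Finset.coe_erase, Set.mem_union, Finset.mem_coe, Set.mem_sdiff,
          Set.mem_singleton_iff]
        tauto
  refine ⟨S ∪ H, le_antisymm (hle H hHW) hHspan, Finset.subset_union_left, ?_⟩
  intro G' hG' hspan
  obtain ⟨g, hgG, hGe⟩ := Finset.ssubset_iff_exists_subset_erase.1 hG'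
  have hgI : g ∈ I := hle H hHW (Ideal.subset_span hgG)
  have hg : g ∈ Ideal.span (((S ∪ H).erase g : Finset _) : Set (MvPolynomial σ K)) :=
    Ideal.span_mono (Finset.coe_subset.2 hGe) (hspan ▸ hgI)
  have hgH : g ∉ H := fun h => hdrop g h hg
  have hgS : g ∈ S := (Finset.mem_union.1 hgG).resolve_right hgH
  have hGI : ∀ k ∈ S ∪ H, k ∈ I := fun k hk => hle H hHW (Ideal.subset_span hk)
  have hdeg : ∀ k : MvPolynomial σ K, ∃ n, k ∈ S ∪ H → k.IsWeightedHomogeneous w n := by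
    intro k
    by_cases hk : k ∈ S ∪ H
    · rcases Finset.mem_union.1 hk with h | h
      · exact (hS k h).imp fun n hn _ => hn
      · exact (hW k (hHW h)).imp fun n hn _ => hn
    · exact ⟨0, fun h => absurd h hk⟩
  choose deg hdeg using hdeg
  obtain ⟨c, -, hc⟩ := Submodule.mem_span_finset.1 hg
  simp only [smul_eq_mul] at hc
  -- homogeneous coefficients
  obtain ⟨e, he⟩ : ∃ e : MvPolynomial σ K → MvPolynomial σ K, ∀ k, e k =
      if deg k ≤ deg g then weightedHomogeneousComponent w (deg g - deg k) (c k) else 0 :=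
    ⟨_, fun _ => rfl⟩
  have hsum : g = ∑ k ∈ (S ∪ H).erase g, e k * k := by
    have hcomp : g = weightedHomogeneousComponent w (deg g) (∑ k ∈ (S ∪ H).erase g, c k * k) := by
      rw [hc, (hdeg g hgG).weightedHomogeneousComponent_same]
    rw [map_sum] at hcomp
    refine hcomp.trans (Finset.sum_congr rfl fun k hk => ?_)
    rw [weightedHomogeneousComponent_mul_right (hdeg k (Finset.mem_of_mem_erase hk)), he]
  have hconst : ∀ k, constantCoeff (e k) ≠ 0 → e k = C (constantCoeff (e k)) := by
    intro k hk
    have hhom : (e k).IsWeightedHomogeneous w (deg g - deg k) := by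
      rw [he]
      split_ifs
      · exact weightedHomogeneousComponent_isWeightedHomogeneous _ _
      · exact isWeightedHomogeneous_zero _ _ _
    have h0 : deg g - deg k = 0 := by
      have := hhom (d := 0) hk
      simpa using this.symm
    rw [h0] at hhom
    conv_lhs => rw [← hhom.weightedHomogeneousComponent_same,
      weightedHomogeneousComponent_zero (e k) hw]
    rfl
  have hH0 : ∀ h ∈ H, constantCoeff (e h) = 0 := by
    intro h hh
    by_contra hne
    have hhg : h ≠ g := fun h' => hgH (h' ▸ hh)
    have hhe : h ∈ (S ∪ H).erase g := Finset.mem_erase.2 ⟨hhg, Finset.mem_union_right _ hh⟩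
    rw [← Finset.add_sum_erase _ _ hhe, hconst h hne] at hsum
    refine hdrop h hh ?_
    have hcc : C (constantCoeff (e h))⁻¹ * C (constantCoeff (e h)) = (1 : MvPolynomial σ K) := by
      rw [← C_mul, inv_mul_cancel₀ hne, C_1]
    have heq : h = C (constantCoeff (e h))⁻¹ *
        (g - ∑ k ∈ ((S ∪ H).erase g).erase h, e k * k) := by
      linear_combination (-h) * hcc - C (constantCoeff (e h))⁻¹ * hsum
    rw [heq]
    refine Ideal.mul_mem_left _ _ (Ideal.sub_mem _ ?_ (Ideal.sum_mem _ fun k hk =>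
      Ideal.mul_mem_left _ _ ?_))
    · rw [← heq]
      exact Ideal.subset_span (Finset.mem_coe.2 (Finset.mem_erase.2 ⟨hhg.symm, hgG⟩))
    · rw [← heq]
      refine Ideal.subset_span (Finset.mem_coe.2 ?_)
      simp only [Finset.mem_erase] at hk ⊢
      tauto
  -- a relation among the elements of `S` modulo `𝔪 * I`
  have hrel := hind (fun k => if k = g then 1 else - constantCoeff (e k)) ?_ g hgS
  · simp at hrel
  have hmem : ∀ k ∈ S ∪ H, (e k - C (constantCoeff (e k))) * k ∈
      RingHom.ker (constantCoeff : MvPolynomial σ K →+* K) * I := fun k hk =>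
    Ideal.mul_mem_mul (by simp [RingHom.mem_ker]) (hGI k hk)
  have hsum2 : ∑ k ∈ (S ∪ H).erase g, C (constantCoeff (e k)) * k =
      ∑ k ∈ S.erase g, C (constantCoeff (e k)) * k := by
    symm
    refine Finset.sum_subset (Finset.erase_subset_erase _ Finset.subset_union_left) ?_
    intro k hk hk'
    have : k ∈ H := by
      simp only [Finset.mem_erase, Finset.mem_union] at hk hk'
      tauto
    rw [hH0 k this, C_0, zero_mul]
  have : ∑ k ∈ S, C (if k = g then 1 else - constantCoeff (e k)) * k =
      ∑ k ∈ (S ∪ H).erase g, (e k - C (constantCoeff (e k))) * k := by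
    simp only [sub_mul, Finset.sum_sub_distrib]
    rw [← hsum, hsum2, ← Finset.add_sum_erase _ _ hgS, if_pos rfl, C_1, one_mul, sub_eq_add_neg,
      ← Finset.sum_neg_distrib]
    congr 1
    refine Finset.sum_congr rfl fun k hk => ?_
    rw [if_neg (Finset.ne_of_mem_erase hk), C_neg, neg_mul]
  rw [this]
  exact Ideal.sum_mem _ fun k hk => hmem k (Finset.mem_of_mem_erase hk)

end MinimalGenerators

section Lifting

variable {K : Type} [Field K] {A B : Fin 3 → PT K}

theorem exists_isHomogeneous_sum_mul_eq {μ1 μ2 : ℕ}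
    (hA : ∀ i, (A i).IsHomogeneous μ1) (hB : ∀ i, (B i).IsHomogeneous μ2)
    (hgen : ∀ h : Fin 3 → PT K, (∑ i : Fin 3, h i * crossProd K A B i = 0) →
      ∃ u v : PT K, ∀ i, h i = u * A i + v * B i)
    (hindep : ∀ u v : PT K, (∀ i, u * A i + v * B i = 0) → u = 0 ∧ v = 0)
    {t : ℕ} (ht : μ1 + μ2 ≤ t + 1) {c e : PT K}
    (hc : c.IsHomogeneous (t + μ1)) (he : e.IsHomogeneous (t + μ2)) :
    ∃ g : Fin 3 → PT K, (∀ i, (g i).IsHomogeneous t) ∧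
      ∑ i, g i * A i = c ∧ ∑ i, g i * B i = e := by
  have hfd : ∀ n, Module.Finite K (homogeneousSubmodule (Fin 2) K n) := fun n =>
    Module.Finite.iff_fg.2 (homogeneousSubmodule_fg (Fin 2) K n)
  let V := Fin 3 → homogeneousSubmodule (Fin 2) K t
  let pair : ∀ {μ : ℕ} (M : Fin 3 → PT K), (∀ i, (M i).IsHomogeneous μ) →
      V →ₗ[K] homogeneousSubmodule (Fin 2) K (t + μ) := fun {μ} M hM =>
    LinearMap.codRestrict _
      (∑ i, (LinearMap.mulRight K (M i)) ∘ₗ (Submodule.subtype _) ∘ₗ (LinearMap.proj i))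
      fun g => by
        simp only [LinearMap.sum_apply]
        exact Submodule.sum_mem _ fun i _ => (g i).2.mul (hM i)
  have hpair : ∀ {μ : ℕ} (M : Fin 3 → PT K) (hM : ∀ i, (M i).IsHomogeneous μ) (g : V),
      (pair M hM g : PT K) = ∑ i, (g i : PT K) * M i := by
    intro μ M hM g
    simp [pair]
    rfl
  let Φ := (pair A hA).prod (pair B hB)
  have hker : Module.finrank K (LinearMap.ker Φ) + (μ1 + μ2) ≤ t + 1 := by
    have hmem : ∀ g ∈ LinearMap.ker Φ, ∃ u : PT K, ∀ i, (g i : PT K) =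
        (if μ1 + μ2 ≤ t then homogeneousComponent (t - (μ1 + μ2)) u else 0) *
          crossProd K A B i := by
      intro g hg
      have hg' := LinearMap.mem_ker.1 hg
      obtain ⟨u, hu⟩ := exists_eq_mul_crossProd hgen hindep
        (g := fun i => (g i : PT K))
        (by rw [← hpair A hA]; exact congrArg Subtype.val (congrArg Prod.fst hg'))
        (by rw [← hpair B hB]; exact congrArg Subtype.val (congrArg Prod.snd hg'))
      refine ⟨u, fun i => ?_⟩
      have h := weightedHomogeneousComponent_mul_right (w := 1)
        (isHomogeneous_crossProd hA hB i) u t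
      rw [← hu i, IsWeightedHomogeneous.weightedHomogeneousComponent_same (g i).2] at h
      exact h
    by_cases hμ : μ1 + μ2 ≤ t
    · let Ψ : homogeneousSubmodule (Fin 2) K (t - (μ1 + μ2)) →ₗ[K] V := LinearMap.pi fun i =>
        LinearMap.codRestrict _ ((LinearMap.mulRight K (crossProd K A B i)) ∘ₗ
          (Submodule.subtype _)) fun u => by
            have := (u.2 : (u : PT K).IsHomogeneous _).mul (isHomogeneous_crossProd hA hB i)
            rwa [Nat.sub_add_cancel hμ] at this
      have hle : LinearMap.ker Φ ≤ LinearMap.range Ψ := by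
        intro g hg
        obtain ⟨u, hu⟩ := hmem g hg
        refine ⟨⟨_, homogeneousComponent_isHomogeneous (t - (μ1 + μ2)) u⟩, ?_⟩
        ext i : 2
        rw [hu i, if_pos hμ]
        simp [Ψ]
        rfl
      have h1 := Submodule.finrank_mono hle
      have h2 := LinearMap.finrank_range_le Ψ
      rw [finrank_homogeneousSubmodule_fin_two] at h2
      omega
    · have hbot : LinearMap.ker Φ = ⊥ := by
        refine (Submodule.eq_bot_iff _).2 fun g hg => ?_
        obtain ⟨u, hu⟩ := hmem g hg
        ext i : 2
        rw [hu i, if_neg hμ, zero_mul]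
        rfl
      rw [hbot, finrank_bot]
      omega
  have hrank := LinearMap.finrank_range_add_finrank_ker Φ
  have hV : Module.finrank K V = 3 * (t + 1) := by
    simp [V, Module.finrank_pi_fintype, finrank_homogeneousSubmodule_fin_two]
  have htop : LinearMap.range Φ = ⊤ := by
    refine Submodule.eq_top_of_finrank_eq (le_antisymm (Submodule.finrank_le _) ?_)
    rw [Module.finrank_prod, finrank_homogeneousSubmodule_fin_two,
      finrank_homogeneousSubmodule_fin_two]
    omega
  obtain ⟨g, hg⟩ := LinearMap.range_eq_top.1 htop (⟨c, hc⟩, ⟨e, he⟩)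
  refine ⟨fun i => g i, fun i => (g i).2, ?_, ?_⟩
  · rw [← hpair A hA]
    exact congrArg Subtype.val (congrArg Prod.fst hg)
  · rw [← hpair B hB]
    exact congrArg Subtype.val (congrArg Prod.snd hg)

@[simp] theorem OmegaMap_X_inr (i : Fin 3) : OmegaMap K A B (X (Sum.inr i)) =
    rename Sum.inl (A i) * X (Sum.inr 0) + rename Sum.inl (B i) * X (Sum.inr 1) := by
  simp [OmegaMap]

@[simp] theorem OmegaMap_rename_inl (c : PT K) :
    OmegaMap K A B (rename Sum.inl c) = rename Sum.inl c := by
  rw [OmegaMap, aeval_rename, rename_eq_aeval]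
  rfl

theorem isWeightedHomogeneous_rename {σ τ R : Type*} [CommSemiring R] {w : τ → ℕ} {e : σ → τ}
    {n : ℕ} {φ : MvPolynomial σ R} (hφ : φ.IsWeightedHomogeneous (w ∘ e) n) :
    (rename e φ).IsWeightedHomogeneous w n := by
  intro d hd
  obtain ⟨u, rfl, hu⟩ := coeff_rename_ne_zero e φ d hd
  rw [← hφ hu, Finsupp.weight_apply, Finsupp.weight_apply,
    Finsupp.sum_mapDomain_index (by simp) (by intros; simp [add_mul])]
  rfl

theorem isWeightedHomogeneous_wT_sum_mul_X {F : Fin 3 → PTZ K} {t : ℕ}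
    (hF : ∀ i, (F i).IsWeightedHomogeneous wT t) :
    (∑ i, F i * X (Sum.inr i)).IsWeightedHomogeneous wT t :=
  IsWeightedHomogeneous.sum _ _ _ fun i _ => (hF i).mul (isWeightedHomogeneous_X K wT (Sum.inr i))

theorem isWeightedHomogeneous_wZ_sum_mul_X {F : Fin 3 → PTZ K} {n : ℕ}
    (hF : ∀ i, (F i).IsWeightedHomogeneous wZ n) :
    (∑ i, F i * X (Sum.inr i)).IsWeightedHomogeneous wZ (n + 1) :=
  IsWeightedHomogeneous.sum _ _ _ fun i _ => (hF i).mul (isWeightedHomogeneous_X K wZ (Sum.inr i))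

theorem OmegaMap_sum_mul_X {F : Fin 3 → PTZ K} {g : Fin 3 → PT K} {m : PTXY K}
    (hF : ∀ i, OmegaMap K A B (F i) = rename Sum.inl (g i) * m) :
    OmegaMap K A B (∑ i, F i * X (Sum.inr i)) =
      (rename Sum.inl (∑ i, g i * A i) * X (Sum.inr 0) +
        rename Sum.inl (∑ i, g i * B i) * X (Sum.inr 1)) * m := by
  simp only [Fin.sum_univ_three, map_add, map_mul, OmegaMap_X_inr, hF]
  ring

/-- In `T`-degrees at least `μ - 1` every monomial of `K[T0,T1][X,Y]` lifts along `Ω`. -/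
theorem exists_OmegaMap_eq_monomial {μ1 μ2 : ℕ}
    (hA : ∀ i, (A i).IsHomogeneous μ1) (hB : ∀ i, (B i).IsHomogeneous μ2)
    (hgen : ∀ h : Fin 3 → PT K, (∑ i : Fin 3, h i * crossProd K A B i = 0) →
      ∃ u v : PT K, ∀ i, h i = u * A i + v * B i)
    (hindep : ∀ u v : PT K, (∀ i, u * A i + v * B i = 0) → u = 0 ∧ v = 0)
    {t : ℕ} (ht : μ1 + μ2 ≤ t + 1) (a b : ℕ) {c : PT K}
    (hc : c.IsHomogeneous (t + a * μ1 + b * μ2)) :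
    ∃ F : PTZ K, F.IsWeightedHomogeneous wT t ∧ F.IsWeightedHomogeneous wZ (a + b) ∧
      OmegaMap K A B F = rename Sum.inl c * (X (Sum.inr 0) ^ a * X (Sum.inr 1) ^ b) := by
  induction a generalizing c with
  | zero =>
    induction b generalizing c with
    | zero =>
      refine ⟨rename Sum.inl c, isWeightedHomogeneous_rename ?_,
        isWeightedHomogeneous_rename ?_, by simp⟩
      · have hc' : c.IsHomogeneous t := by simpa using hc
        exact hc'
      · intro d _
        simp [Finsupp.weight_apply, wZ]
    | succ b ih =>
      obtain ⟨g, hg, hgA, hgB⟩ := exists_isHomogeneous_sum_mul_eq hA hB hgen hindep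
        (t := t + 0 * μ1 + b * μ2) (by omega) (isHomogeneous_zero _ _ _) (e := c)
        (by convert hc using 1; ring)
      choose F hFT hFZ hF using fun i => ih (hg i)
      refine ⟨∑ i, F i * X (Sum.inr i), isWeightedHomogeneous_wT_sum_mul_X hFT, ?_, ?_⟩
      · exact isWeightedHomogeneous_wZ_sum_mul_X hFZ
      · rw [OmegaMap_sum_mul_X hF, hgA, hgB, map_zero]
        ring
  | succ a ih =>
    obtain ⟨g, hg, hgA, hgB⟩ := exists_isHomogeneous_sum_mul_eq hA hB hgen hindep
      (t := t + a * μ1 + b * μ2) (by omega) (c := c) (by convert hc using 1; ring)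
      (isHomogeneous_zero _ _ _)
    choose F hFT hFZ hF using fun i => ih (hg i)
    refine ⟨∑ i, F i * X (Sum.inr i), isWeightedHomogeneous_wT_sum_mul_X hFT, ?_, ?_⟩
    · convert isWeightedHomogeneous_wZ_sum_mul_X hFZ using 1
      omega
    · rw [OmegaMap_sum_mul_X hF, hgA, hgB, map_zero]
      ring

end Lifting

section Kernel

variable {K : Type} [Field K]

theorem IsWeightedHomogeneous.isHomogeneous_aeval {σ τ R : Type*} [CommSemiring R] {w : σ → ℕ}
    {g : σ → MvPolynomial τ R} (hg : ∀ i, (g i).IsHomogeneous (w i)) {n : ℕ}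
    {φ : MvPolynomial σ R} (hφ : φ.IsWeightedHomogeneous w n) :
    (aeval g φ).IsHomogeneous n := by
  rw [φ.as_sum, map_sum]
  refine IsHomogeneous.sum _ _ _ fun u hu => ?_
  rw [aeval_monomial, algebraMap_eq, ← hφ (mem_support_iff.1 hu), Finsupp.weight_apply]
  refine IsHomogeneous.C_mul (IsHomogeneous.prod _ _ _ fun i _ => ?_) _
  simpa [mul_comm] using (hg i).pow (u i)

theorem aeval_weightedHomogeneousComponent {σ τ R : Type*} [CommSemiring R] {w : σ → ℕ}
    {g : σ → MvPolynomial τ R} (hg : ∀ i, (g i).IsHomogeneous (w i)) (n : ℕ)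
    (φ : MvPolynomial σ R) :
    aeval g (weightedHomogeneousComponent w n φ) = homogeneousComponent n (aeval g φ) := by
  induction φ using MvPolynomial.induction_on' with
  | monomial u a =>
    have hu := isWeightedHomogeneous_monomial w u a (rfl : Finsupp.weight w u = _)
    rw [weightedHomogeneousComponent_of_mem hu,
      homogeneousComponent_of_mem (IsWeightedHomogeneous.isHomogeneous_aeval hg hu)]
    split_ifs <;> simp
  | add p q hp hq => simp only [map_add, hp, hq]

/-- The grading with `T_i` of degree `1` and `Z_i` of degree `n`. -/
def wTZ (n : ℕ) : Fin 2 ⊕ Fin 3 → ℕ := Sum.elim (fun _ => 1) (fun _ => n)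

theorem isWeightedHomogeneous_wTZ {F : PTZ K} {i j : ℕ} (n : ℕ)
    (hT : F.IsWeightedHomogeneous wT i) (hZ : F.IsWeightedHomogeneous wZ j) :
    F.IsWeightedHomogeneous (wTZ n) (i + n * j) := by
  intro u hu
  rw [← hT hu, ← hZ hu]
  simp [Finsupp.weight_apply, Finsupp.sum_fintype, wT, wZ, wTZ, Finset.mul_sum, mul_comm]

theorem weightedHomogeneousComponent_mem_ker_psiMap {d : ℕ} {f : Fin 3 → PT K}
    (hf : ∀ i, (f i).IsHomogeneous d) (x : PTZ K) (hx : x ∈ RingHom.ker (psiMap K f)) (n : ℕ) :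
    weightedHomogeneousComponent (wTZ (d + 1)) n x ∈ RingHom.ker (psiMap K f) := by
  rw [RingHom.mem_ker] at hx ⊢
  rw [psiMap] at hx ⊢
  rw [aeval_weightedHomogeneousComponent, hx, map_zero]
  rintro (i | i)
  · exact isHomogeneous_X _ _
  · exact (hf i).rename_isHomogeneous.mul (isHomogeneous_X _ _)

theorem psiMap_eq_scaleMap_OmegaMap {α β : PT K} {A B f : Fin 3 → PT K}
    (hf : ∀ i, f i = α * A i + β * B i) (x : PTZ K) :
    psiMap K f x = scaleMap α β (OmegaMap K A B x) := by
  have : psiMap K f = (scaleMap α β).comp (OmegaMap K A B) := by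
    refine MvPolynomial.algHom_ext ?_
    rintro (i | i)
    · simp [psiMap, OmegaMap]
    · simp only [psiMap, AlgHom.comp_apply, aeval_X, Sum.elim_inr, OmegaMap_X_inr, hf, map_add,
        map_mul, scaleMap_rename_inl, scaleMap_X_inr, Matrix.cons_val_zero, Matrix.cons_val_one]
      ring
  rw [this, AlgHom.comp_apply]

theorem pencil_ne_zero {α : PT K} (hα : α ≠ 0) (β : PT K) : pencil α β ≠ 0 := by
  intro h
  let κ : PTXY K →ₐ[K] PT K := aeval (Sum.elim X ![0, 1])
  have hκ : ∀ c, κ (rename Sum.inl c) = c := by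
    intro c
    simp only [κ, aeval_rename]
    exact aeval_X_left_apply c
  refine hα ?_
  have h1 := congrArg κ h
  rw [pencil, map_sub, map_mul, map_mul, hκ, hκ] at h1
  simpa [κ] using h1

/-- Reduction modulo `T0` and `T1`. -/
def evalT : PTXY K →ₐ[K] MvPolynomial (Fin 2) K := aeval (Sum.elim (fun _ => 0) X)

theorem evalT_OmegaMap {μ1 μ2 : ℕ} (h1 : μ1 ≠ 0) (h2 : μ2 ≠ 0) {A B : Fin 3 → PT K}
    (hA : ∀ i, (A i).IsHomogeneous μ1) (hB : ∀ i, (B i).IsHomogeneous μ2) (x : PTZ K) :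
    evalT (OmegaMap K A B x) = C (constantCoeff x) := by
  have hren : ∀ {μ : ℕ} {c : PT K}, μ ≠ 0 → c.IsHomogeneous μ →
      evalT (rename Sum.inl c) = 0 := by
    intro μ c hμ hc
    rw [evalT, aeval_rename]
    have : (Sum.elim (fun _ => 0) X ∘ Sum.inl : Fin 2 → MvPolynomial (Fin 2) K) = 0 := rfl
    rw [this, aeval_zero]
    have h0 : constantCoeff c = 0 := hc.coeff_eq_zero (by simpa using hμ.symm)
    rw [h0, map_zero]
  induction x using MvPolynomial.induction_on with
  | C a => simp [OmegaMap, evalT]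
  | add p q hp hq => simp [hp, hq]
  | mul_X p i hp =>
    rw [map_mul, map_mul, map_mul, constantCoeff_X, mul_zero, C_0]
    rcases i with i | i
    · simp [OmegaMap, evalT]
    · rw [OmegaMap_X_inr, map_add, map_mul, map_mul, hren h1 (hA i), hren h2 (hB i)]
      simp

theorem exists_OmegaMap_eq_pencil_mul {α β : PT K} (hα : α ≠ 0) (h : IsRelPrime α β)
    {μ1 μ2 : ℕ} (h1 : μ1 ≠ 0) (h2 : μ2 ≠ 0) {A B f : Fin 3 → PT K}
    (hA : ∀ i, (A i).IsHomogeneous μ1) (hB : ∀ i, (B i).IsHomogeneous μ2)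
    (hf : ∀ i, f i = α * A i + β * B i) {x : PTZ K}
    (hx : x ∈ RingHom.ker (constantCoeff : PTZ K →+* K) * RingHom.ker (psiMap K f)) :
    ∃ H, evalT H = 0 ∧ OmegaMap K A B x = pencil α β * H := by
  induction hx using Submodule.mul_induction_on' with
  | mem_mul_mem r hr y hy =>
    rw [RingHom.mem_ker] at hr hy
    rw [psiMap_eq_scaleMap_OmegaMap hf] at hy
    obtain ⟨H, hH⟩ := pencil_dvd_of_scaleMap_eq_zero hα h hy
    refine ⟨OmegaMap K A B r * H, ?_, ?_⟩
    · rw [map_mul, evalT_OmegaMap h1 h2 hA hB, hr, C_0, zero_mul]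
    · rw [map_mul, hH]
      ring
  | add y _ z _ hy hz =>
    obtain ⟨H, hH, hy⟩ := hy
    obtain ⟨H', hH', hz⟩ := hz
    exact ⟨H + H', by rw [map_add, hH, hH', add_zero], by rw [map_add, hy, hz, mul_add]⟩

end Kernel

theorem sub_eq_of_condAB {d μ1 μ2 a b : ℕ} (hμ1 : 1 ≤ μ1) (hμ12 : μ1 ≤ μ2)
    (h : CondAB d μ1 μ2 a b) :
    ∃ t, d - (μ1 + μ2) - a * μ1 - b * μ2 = t ∧ μ1 + μ2 ≤ t + 1 ∧
      d - μ1 = t + a * μ1 + (b + 1) * μ2 ∧ d - μ2 = t + (a + 1) * μ1 + b * μ2 := by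
  refine ⟨_, rfl, ?_⟩
  rw [add_mul, add_mul]
  have hb : b = 0 → b * μ2 = 0 := fun hb => by rw [hb, zero_mul]
  rw [CondAB, ← Nat.cast_mul, ← Nat.cast_mul] at h
  generalize a * μ1 = x at *
  generalize b * μ2 = y at *
  omega

theorem condAB_le {d μ1 μ2 a b : ℕ} (hμ1 : 1 ≤ μ1) (hμ12 : μ1 ≤ μ2)
    (h : CondAB d μ1 μ2 a b) : a ≤ d ∧ b ≤ d := by
  obtain ⟨t, -, -, h1, h2⟩ := sub_eq_of_condAB hμ1 hμ12 h
  have ha : a * 1 ≤ a * μ1 := Nat.mul_le_mul_left a hμ1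
  have hb : b * 1 ≤ b * μ2 := Nat.mul_le_mul_left b (hμ1.trans hμ12)
  rw [add_mul] at h1
  omega

theorem exists_mem_ker_psiMap {K : Type} [Field K] {d μ1 μ2 : ℕ} (hμ1 : 1 ≤ μ1) (hμ12 : μ1 ≤ μ2)
    {α β : PT K} (hα : α.IsHomogeneous (d - μ1)) (hβ : β.IsHomogeneous (d - μ2))
    {A B : Fin 3 → PT K}
    (hA : ∀ i, (A i).IsHomogeneous μ1) (hB : ∀ i, (B i).IsHomogeneous μ2)
    (hgen : ∀ h : Fin 3 → PT K, (∑ i : Fin 3, h i * crossProd K A B i = 0) →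
      ∃ u v : PT K, ∀ i, h i = u * A i + v * B i)
    (hindep : ∀ u v : PT K, (∀ i, u * A i + v * B i = 0) → u = 0 ∧ v = 0)
    {f : Fin 3 → PT K} (hf : ∀ i, f i = α * A i + β * B i)
    {a b : ℕ} (h : CondAB d μ1 μ2 a b) :
    ∃ F : PTZ K, psiMap K f F = 0 ∧
      F.IsWeightedHomogeneous wT (d - (μ1 + μ2) - a * μ1 - b * μ2) ∧
      F.IsWeightedHomogeneous wZ (a + b + 1) ∧
      OmegaMap K A B F =
        (-1 : PTXY K) ^ (b + 1) * X (Sum.inr 0) ^ a * X (Sum.inr 1) ^ b *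
          ((rename Sum.inl α : PTXY K) * X (Sum.inr 1)
            - (rename Sum.inl β : PTXY K) * X (Sum.inr 0)) := by
  obtain ⟨t, ht, hμt, hdα, hdβ⟩ := sub_eq_of_condAB hμ1 hμ12 h
  obtain ⟨P, hPT, hPZ, hP⟩ := exists_OmegaMap_eq_monomial hA hB hgen hindep hμt a (b + 1)
    (hdα ▸ hα)
  obtain ⟨Q, hQT, hQZ, hQ⟩ := exists_OmegaMap_eq_monomial hA hB hgen hindep hμt (a + 1) b
    (hdβ ▸ hβ)
  have hQZ' : Q.IsWeightedHomogeneous wZ (a + b + 1) := by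
    convert hQZ using 1
    ring
  have hΩ : OmegaMap K A B (C ((-1) ^ (b + 1)) * (P - Q)) =
      (-1 : PTXY K) ^ (b + 1) * X (Sum.inr 0) ^ a * X (Sum.inr 1) ^ b * pencil α β := by
    rw [map_mul, map_sub, hP, hQ, pencil, ← algebraMap_eq, AlgHom.commutes, algebraMap_eq]
    simp only [C_pow, C_neg, C_1]
    ring
  refine ⟨C ((-1) ^ (b + 1)) * (P - Q), ?_, ?_, (hPZ.sub hQZ').C_mul _, hΩ⟩
  · rw [psiMap_eq_scaleMap_OmegaMap hf, hΩ, map_mul, scaleMap_pencil, mul_zero]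
  · rw [ht]
    exact (hPT.sub hQT).C_mul _

theorem evalT_monomial {K : Type} [Field K] (r : K) (a b : ℕ) :
    evalT (C r * (X (Sum.inr 0) ^ a * X (Sum.inr 1) ^ b) : PTXY K) =
      monomial (Finsupp.single 0 a + Finsupp.single 1 b) r := by
  have h (j : Fin 2) : evalT (X (Sum.inr j) : PTXY K) = X j := by simp [evalT]
  have hC : evalT (C r : PTXY K) = C r := by simp [evalT]
  rw [map_mul, map_mul, map_pow, map_pow, h, h, hC]
  simp [X_pow_eq_monomial, C_mul_monomial, monomial_mul]

theorem single_add_single_injective :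
    Function.Injective fun p : ℕ × ℕ =>
      (Finsupp.single 0 p.1 + Finsupp.single 1 p.2 : Fin 2 →₀ ℕ) := by
  intro p p' h
  have h0 := DFunLike.congr_fun h 0
  have h1 := DFunLike.congr_fun h 1
  exact Prod.ext (by simpa using h0) (by simpa using h1)

theorem stmt17 (K : Type) [Field K] (d μ1 μ2 : ℕ) (hμ1 : 1 ≤ μ1) (hμ12 : μ1 ≤ μ2)
    (hd : 2 * (μ1 + μ2) ≤ d)
    (α β : PT K) (hα0 : α ≠ 0) (hβ0 : β ≠ 0)
    (hα : α.IsHomogeneous (d - μ1)) (hβ : β.IsHomogeneous (d - μ2))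
    (hcop : ∀ c : PT K, c ∣ α → c ∣ β → IsUnit c)
    (A B : Fin 3 → PT K)
    (hAhom : ∀ i, (A i).IsHomogeneous μ1) (hBhom : ∀ i, (B i).IsHomogeneous μ2)
    (hsyzA : ∑ i : Fin 3, A i * crossProd K A B i = 0)
    (hsyzB : ∑ i : Fin 3, B i * crossProd K A B i = 0)
    (hgen : ∀ h : Fin 3 → PT K, (∑ i : Fin 3, h i * crossProd K A B i = 0) →
      ∃ u v : PT K, ∀ i, h i = u * A i + v * B i)
    (hindep : ∀ u v : PT K, (∀ i, u * A i + v * B i = 0) → u = 0 ∧ v = 0)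
    (f : Fin 3 → PT K) (hf : ∀ i, f i = α * A i + β * B i)
    (q : Fin 3 → PT K)
    (hqhom : ∀ i, (q i).IsHomogeneous (d - (μ1 + μ2)))
    (hfq : ∀ i, f i = crossProd K (crossProd K A B) q i) :
    ∃ F : ℕ → ℕ → PTZ K,
      (∀ a b : ℕ, CondAB d μ1 μ2 a b →
        psiMap K f (F a b) = 0 ∧
        (F a b).IsWeightedHomogeneous wT (d - (μ1 + μ2) - a * μ1 - b * μ2) ∧
        (F a b).IsWeightedHomogeneous wZ (a + b + 1) ∧
        OmegaMap K A B (F a b) =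
          (-1 : PTXY K) ^ (b + 1) * X (Sum.inr 0) ^ a * X (Sum.inr 1) ^ b *
            ((rename Sum.inl α : PTXY K) * X (Sum.inr 1)
              - (rename Sum.inl β : PTXY K) * X (Sum.inr 0))) ∧
      ∃ G : Finset (PTZ K),
        Ideal.span (G : Set (PTZ K)) = RingHom.ker (psiMap K f) ∧
        (∀ a b : ℕ, CondAB d μ1 μ2 a b → F a b ∈ G) ∧
        ∀ G' ⊂ G, Ideal.span (G' : Set (PTZ K)) ≠ RingHom.ker (psiMap K f) := by
  classical
  have hF : ∀ a b : ℕ, ∃ F : PTZ K, CondAB d μ1 μ2 a b →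
      psiMap K f F = 0 ∧
      F.IsWeightedHomogeneous wT (d - (μ1 + μ2) - a * μ1 - b * μ2) ∧
      F.IsWeightedHomogeneous wZ (a + b + 1) ∧
      OmegaMap K A B F =
        (-1 : PTXY K) ^ (b + 1) * X (Sum.inr 0) ^ a * X (Sum.inr 1) ^ b *
          ((rename Sum.inl α : PTXY K) * X (Sum.inr 1)
            - (rename Sum.inl β : PTXY K) * X (Sum.inr 0)) := by
    intro a b
    by_cases h : CondAB d μ1 μ2 a b
    · exact (exists_mem_ker_psiMap hμ1 hμ12 hα hβ hAhom hBhom hgen hindep hf h).imp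
        fun F hF _ => hF
    · exact ⟨0, fun h' => absurd h' h⟩
  choose F hF using hF
  refine ⟨F, hF, ?_⟩
  have hΩ : ∀ a b : ℕ, CondAB d μ1 μ2 a b → OmegaMap K A B (F a b) =
      pencil α β * (C ((-1) ^ (b + 1)) * (X (Sum.inr 0) ^ a * X (Sum.inr 1) ^ b)) := by
    intro a b h
    rw [(hF a b h).2.2.2, pencil]
    simp only [C_pow, C_neg, C_1]
    ring
  have hD : pencil α β ≠ 0 := pencil_ne_zero hα0 β
  have hsgn : ∀ n : ℕ, ((-1 : K) ^ n) ≠ 0 := fun n => pow_ne_zero n (neg_ne_zero.2 one_ne_zero)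
  let P : Finset (ℕ × ℕ) :=
    (Finset.range (d + 1) ×ˢ Finset.range (d + 1)).filter fun p => CondAB d μ1 μ2 p.1 p.2
  have hP : ∀ p : ℕ × ℕ, p ∈ P ↔ CondAB d μ1 μ2 p.1 p.2 := by
    intro p
    simp only [P, Finset.mem_filter, Finset.mem_product, Finset.mem_range, and_iff_right_iff_imp]
    intro h
    have := condAB_le hμ1 hμ12 h
    omega
  have hinj : Set.InjOn (fun p : ℕ × ℕ => F p.1 p.2) P := by
    intro p hp p' hp' h
    have h1 := congrArg (OmegaMap K A B) h
    simp only [hΩ _ _ ((hP p).1 hp), hΩ _ _ ((hP p').1 hp')] at h1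
    have h2 := congrArg evalT (mul_left_cancel₀ hD h1)
    rw [evalT_monomial, evalT_monomial, monomial_eq_monomial_iff] at h2
    rcases h2 with h2 | h2
    · exact single_add_single_injective h2.1
    · exact absurd h2.1 (hsgn _)
  have hfhom : ∀ i, (f i).IsHomogeneous d := by
    intro i
    rw [hf]
    refine IsHomogeneous.add ?_ ?_
    · convert hα.mul (hAhom i) using 1
      omega
    · convert hβ.mul (hBhom i) using 1
      omega
  obtain ⟨G, hG, hSG, hmin⟩ := exists_irredundant_generators (wTZ (d + 1))
    (by rintro (i | i) <;> simp [wTZ]) (RingHom.ker (psiMap K f))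
    (weightedHomogeneousComponent_mem_ker_psiMap hfhom)
    (P.image fun p => F p.1 p.2)
    (fun g hg => by
      obtain ⟨p, hp, rfl⟩ := Finset.mem_image.1 hg
      exact (hF _ _ ((hP p).1 hp)).1)
    (fun g hg => by
      obtain ⟨p, hp, rfl⟩ := Finset.mem_image.1 hg
      have h := hF _ _ ((hP p).1 hp)
      exact ⟨_, isWeightedHomogeneous_wTZ (d + 1) h.2.1 h.2.2.1⟩)
    (fun c hc => by
      obtain ⟨H, hH0, hH⟩ := exists_OmegaMap_eq_pencil_mul hα0 (fun _ h h' => hcop _ h h')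
        (by omega) (by omega) hAhom hBhom hf hc
      rw [Finset.sum_image hinj, map_sum] at hH
      have hH' : ∑ p ∈ P, C (c (F p.1 p.2) * (-1) ^ (p.2 + 1)) *
          (X (Sum.inr 0) ^ p.1 * X (Sum.inr 1) ^ p.2) = H := by
        refine mul_left_cancel₀ hD (Eq.trans ?_ hH)
        rw [Finset.mul_sum]
        refine Finset.sum_congr rfl fun p hp => ?_
        have hC (r : K) : OmegaMap K A B (C r) = C r := by simp [OmegaMap]
        rw [map_mul (OmegaMap K A B), hΩ _ _ ((hP p).1 hp), hC, map_mul]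
        simp only [C_pow, C_neg, C_1]
        ring
      rw [← hH', map_sum] at hH0
      simp only [evalT_monomial] at hH0
      intro g hg
      obtain ⟨p, hp, rfl⟩ := Finset.mem_image.1 hg
      have h := congrArg (coeff (Finsupp.single 0 p.1 + Finsupp.single 1 p.2)) hH0
      rw [coeff_sum, Finset.sum_eq_single p, coeff_monomial, if_pos rfl, coeff_zero] at h
      · exact (mul_eq_zero.1 h).resolve_right (hsgn _)
      · intro p' _ hne
        rw [coeff_monomial, if_neg fun h' => hne (single_add_single_injective h')]
      · exact fun h' => absurd hp h')
  exact ⟨G, hG, fun a b h => hSG (Finset.mem_image.2 ⟨(a, b), (hP (a, b)).2 h, rfl⟩), hmin⟩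
end
end
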